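/- Fix ℓ ≥ r ≥ 3, δ > 0, and a simple graph H with chromatic number ℓ+1, and set ε = δ/3. There exists n₀ such that for all n ≥ n₀ the following holds: if G is an n-vertex simple graph containing no subgraph isomorphic to H and containing at least (1−ε)·t_r(n,ℓ) cliques on r vertices, then the vertex set of G has a partition V₁ ∪ … ∪ V_ℓ such that the number of edges of G with both endpoints in the same part is at most δ·n². -/

import Mathlib

open Finset
open scoped Classical

/-- `turanCount n ℓ r` is `t_r(n,ℓ)`: the number of `r`-element subsets of `[n]`
that meet each class of the balanced partition of `[n]` into `ℓ` parts
(given by residues modulo `ℓ`) in at most one vertex; equivalently, the number of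
cliques on `r` vertices in the Turán graph `T₂(n,ℓ)`. -/
def turanCount (n ℓ r : ℕ) : ℕ :=
  ((Finset.univ : Finset (Finset (Fin n))).filter
    (fun A => A.card = r ∧ ∀ x ∈ A, ∀ y ∈ A, x ≠ y → x.val % ℓ ≠ y.val % ℓ)).card

section AdjCount

variable {V : Type*}

/-- The number of ordered pairs of `A × B` that are adjacent in `G`. -/
noncomputable def adjCount (G : SimpleGraph V) (A B : Finset V) : ℝ :=
  ∑ x ∈ A, ((B.filter (G.Adj x)).card : ℝ)

/-- The subgraph of `G` formed by the edges inside the classes of `f`. -/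
def withinClasses {α : Type*} (G : SimpleGraph V) (f : V → α) : SimpleGraph V where
  Adj x y := G.Adj x y ∧ f x = f y
  symm := ⟨fun _ _ h => ⟨h.1.symm, h.2.symm⟩⟩
  loopless := ⟨fun x h => G.loopless.irrefl x h.1⟩

lemma adjCount_comm (G : SimpleGraph V) (A B : Finset V) : adjCount G A B = adjCount G B A := by
  unfold adjCount
  have h := sum_card_bipartiteAbove_eq_sum_card_bipartiteBelow (r := G.Adj) (s := A) (t := B)
  simp only [bipartiteAbove, bipartiteBelow] at h
  simp_rw [G.adj_comm] at h ⊢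
  exact_mod_cast h

lemma adjCount_union_left [DecidableEq V] (G : SimpleGraph V) {A A' : Finset V} (h : Disjoint A A')
    (B : Finset V) : adjCount G (A ∪ A') B = adjCount G A B + adjCount G A' B :=
  sum_union h

lemma adjCount_union_right [DecidableEq V] (G : SimpleGraph V) (A : Finset V) {B B' : Finset V}
    (h : Disjoint B B') : adjCount G A (B ∪ B') = adjCount G A B + adjCount G A B' := by
  rw [adjCount_comm, adjCount_union_left G h, adjCount_comm G B, adjCount_comm G B']

lemma adjCount_le (G : SimpleGraph V) (A B : Finset V) :
    adjCount G A B ≤ A.card * B.card := by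
  unfold adjCount
  rw [← nsmul_eq_mul]
  exact sum_le_card_nsmul _ _ _ fun x _ => by exact_mod_cast card_filter_le _ _

lemma adjCount_mono {G G' : SimpleGraph V} {A B : Finset V}
    (h : ∀ x ∈ A, ∀ y ∈ B, G.Adj x y → G'.Adj x y) : adjCount G A B ≤ adjCount G' A B := by
  refine sum_le_sum fun x hx => ?_
  refine Nat.cast_le.2 (card_le_card fun y hy => ?_)
  rw [mem_filter] at hy ⊢
  exact ⟨hy.1, h x hx y hy.1 hy.2⟩

lemma adjCount_eq_zero {G : SimpleGraph V} {A B : Finset V}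
    (h : ∀ x ∈ A, ∀ y ∈ B, ¬ G.Adj x y) : adjCount G A B = 0 := by
  refine sum_eq_zero fun x hx => ?_
  rw [filter_false_of_mem (h x hx)]
  simp

lemma two_mul_card_edgeFinset [Fintype V] (G : SimpleGraph V) [DecidableRel G.Adj] :
    2 * (G.edgeFinset.card : ℝ) = adjCount G univ univ := by
  have h := G.sum_degrees_eq_twice_card_edges
  have h' : adjCount G univ univ = ∑ x, (G.degree x : ℝ) := by
    refine sum_congr rfl fun x _ => ?_
    rw [← SimpleGraph.card_neighborFinset_eq_degree]
    congr 2
    ext y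
    simp
  rw [h']
  exact_mod_cast h.symm

end AdjCount

section CliqueCounts

variable {V : Type*} [Fintype V] [DecidableEq V]

/-- The common neighbours of the vertices in `D`. -/
noncomputable def commonNbrs (G : SimpleGraph V) (D : Finset V) : Finset V :=
  univ.filter fun v => ∀ u ∈ D, G.Adj u v

lemma mem_commonNbrs {G : SimpleGraph V} {D : Finset V} {v : V} :
    v ∈ commonNbrs G D ↔ ∀ u ∈ D, G.Adj u v := by
  simp [commonNbrs]

lemma sum_erase_cliqueFinset (G : SimpleGraph V) (s : ℕ) (F : Finset V → ℝ) :
    ∑ C ∈ G.cliqueFinset (s + 1), ∑ v ∈ C, F (C.erase v) =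
      ∑ D ∈ G.cliqueFinset s, ((commonNbrs G D).card : ℝ) * F D := by
  have h : ∀ D ∈ G.cliqueFinset s, ((commonNbrs G D).card : ℝ) * F D =
      ∑ _v ∈ commonNbrs G D, F D := by
    intro D _
    rw [sum_const, nsmul_eq_mul]
  rw [sum_congr rfl h, sum_sigma', sum_sigma']
  refine sum_bij' (fun p _ => ⟨p.1.erase p.2, p.2⟩) (fun p _ => ⟨insert p.2 p.1, p.2⟩) ?_ ?_ ?_ ?_ ?_
  · rintro ⟨C, v⟩ hp
    simp only [mem_sigma, SimpleGraph.mem_cliqueFinset_iff] at hp ⊢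
    obtain ⟨⟨hC, hc⟩, hv⟩ := hp
    refine ⟨⟨hC.subset (by simp), by simp [hv, hc]⟩, ?_⟩
    rw [mem_commonNbrs]
    intro u hu
    rw [mem_erase] at hu
    exact hC hu.2 hv hu.1
  · rintro ⟨D, v⟩ hp
    simp only [mem_sigma, SimpleGraph.mem_cliqueFinset_iff, mem_commonNbrs] at hp ⊢
    exact ⟨hp.1.insert fun u hu => (hp.2 u hu).symm, mem_insert_self _ _⟩
  · rintro ⟨C, v⟩ hp
    simp only [mem_sigma] at hp
    simp [insert_erase hp.2]
  · rintro ⟨D, v⟩ hp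
    simp only [mem_sigma, mem_commonNbrs] at hp
    have : v ∉ D := fun h => G.loopless.irrefl v (hp.2 v h)
    simp [erase_insert this]
  · intros; rfl

lemma sum_card_commonNbrs (G : SimpleGraph V) (s : ℕ) :
    ∑ D ∈ G.cliqueFinset s, ((commonNbrs G D).card : ℝ) =
      (s + 1) * (G.cliqueFinset (s + 1)).card := by
  have h := sum_erase_cliqueFinset G s fun _ => 1
  simp only [mul_one] at h
  rw [← h]
  have : ∀ C ∈ G.cliqueFinset (s + 1), ∑ _v ∈ C, (1 : ℝ) = s + 1 := by
    intro C hC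
    rw [SimpleGraph.mem_cliqueFinset_iff] at hC
    simp [hC.card_eq]
  rw [sum_congr rfl this, sum_const, nsmul_eq_mul, mul_comm]

lemma sum_card_commonNbrs_erase_le (G : SimpleGraph V) (s : ℕ) (C : Finset V)
    (hC : C.card = s + 1) :
    ∑ v ∈ C, ((commonNbrs G (C.erase v)).card : ℝ) ≤
      s * (commonNbrs G C).card + Fintype.card V := by
  have h1 : ∑ v ∈ C, (commonNbrs G (C.erase v)).card =
      ∑ u : V, (C.filter fun v => u ∈ commonNbrs G (C.erase v)).card := by
    refine Eq.trans (sum_congr rfl fun v _ => ?_)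
      (sum_card_bipartiteAbove_eq_sum_card_bipartiteBelow
        (r := fun v u => u ∈ commonNbrs G (C.erase v)) (s := C) (t := univ))
    congr 1
    ext u
    simp [bipartiteAbove]
  have h2 : ∀ u : V, (C.filter fun v => u ∈ commonNbrs G (C.erase v)).card ≤
      (if u ∈ commonNbrs G C then s else 0) + 1 := by
    intro u
    split_ifs with hu
    · exact (card_filter_le _ _).trans hC.le
    · rw [zero_add, card_le_one]
      intro a ha b hb
      by_contra hab
      simp only [mem_filter, mem_commonNbrs, mem_erase] at ha hb
      refine hu (mem_commonNbrs.2 fun w hw => ?_)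
      by_cases hwa : w = a
      · exact hb.2 w ⟨hwa ▸ hab, hw⟩
      · exact ha.2 w ⟨hwa, hw⟩
  have h3 : ∑ v ∈ C, (commonNbrs G (C.erase v)).card ≤
      s * (commonNbrs G C).card + Fintype.card V := by
    rw [h1]
    refine (sum_le_sum fun u _ => h2 u).trans ?_
    rw [sum_add_distrib]
    simp [mul_comm]
  exact_mod_cast h3

/-- The Moon–Moser inequality. -/
lemma moon_moser (G : SimpleGraph V) (s : ℕ) :
    (((s : ℝ) + 1) * (G.cliqueFinset (s + 1)).card) ^ 2 ≤
      (G.cliqueFinset s).card * (s * ((s + 2) * (G.cliqueFinset (s + 2)).card) +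
        Fintype.card V * (G.cliqueFinset (s + 1)).card) := by
  rw [← sum_card_commonNbrs G s]
  refine (sq_sum_le_card_mul_sum_sq).trans ?_
  refine mul_le_mul_of_nonneg_left ?_ (Nat.cast_nonneg _)
  have h1 := sum_erase_cliqueFinset G s fun D => ((commonNbrs G D).card : ℝ)
  have h2 := sum_card_commonNbrs G (s + 1)
  simp_rw [sq]
  rw [← h1]
  refine (sum_le_sum fun C hC => sum_card_commonNbrs_erase_le G s C ?_).trans ?_
  · rw [SimpleGraph.mem_cliqueFinset_iff] at hC
    exact hC.card_eq
  · rw [sum_add_distrib, ← mul_sum, h2, sum_const, nsmul_eq_mul]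
    push_cast
    apply le_of_eq
    ring

/-- A quantitative form of: if a sequence satisfies the normalised Moon–Moser inequalities and
vanishes at `ℓ + 1`, its ratios are at most those of the Turán densities. -/
lemma ratio_le_of_moon_moser (ℓ : ℕ) (hℓ : 0 < ℓ) (d : ℕ) : ∀ (s : ℕ), s + d = ℓ →
    ∀ η : ℝ, 0 < η → ∃ γ > 0, ∀ b : ℕ → ℝ, (∀ i, 0 ≤ b i) → (∀ i, b i ≤ 1) →
      (∀ i : ℕ, (((i : ℝ) + 1) * b (i + 1)) ^ 2 ≤
        b i * (i * ((i + 2) * b (i + 2)) + b (i + 1))) →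
      b (ℓ + 1) ≤ γ → ((s : ℝ) + 1) * b (s + 1) ≤ ((ℓ - s : ℝ) / ℓ) * b s + η := by
  have hℓ' : (0 : ℝ) < ℓ := by exact_mod_cast hℓ
  induction d with
  | zero =>
    intro s hs η hη
    obtain rfl : s = ℓ := by omega
    refine ⟨η / (s + 1), by positivity, fun b _ _ _ hb => ?_⟩
    rw [le_div_iff₀ (by positivity)] at hb
    simp only [sub_self, zero_div, zero_mul, zero_add]
    linarith
  | succ d ih =>
    intro s hs η hη
    obtain ⟨γ, hγ, h⟩ := ih (s + 1) (by omega) (η ^ 2 / (s + 1)) (by positivity)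
    refine ⟨γ, hγ, fun b hb0 hb1 hM hb => ?_⟩
    have h1 := h b hb0 hb1 hM hb
    have h2 := hM s
    have hsℓ : (s : ℝ) + 1 ≤ ℓ := by exact_mod_cast (by omega : s + 1 ≤ ℓ)
    have hs0 : (0 : ℝ) ≤ s := Nat.cast_nonneg s
    push_cast at h1
    have hx0 := hb0 (s + 1)
    have hy0 := hb0 s
    have hy1 := hb1 s
    set x := b (s + 1)
    set y := b s
    set z := b (s + 1 + 1)
    change (((s : ℝ) + 1) * x) ^ 2 ≤ y * (s * ((s + 2) * z) + x) at h2
    by_contra! hlt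
    set c : ℝ := (ℓ - s) / ℓ with hc
    have hc0 : 0 ≤ c := div_nonneg (by linarith) hℓ'.le
    have hcx : (s : ℝ) * ((ℓ - (s + 1)) / ℓ) + 1 = (s + 1) * c := by
      rw [hc]; field_simp; ring
    set e : ℝ := η ^ 2 / (s + 1) with he
    have hee : e * (s + 1) = η ^ 2 := by rw [he]; field_simp
    have he0 : 0 < e := by positivity
    have h3 : (s : ℝ) * ((s + 2) * z) + x ≤ (s + 1) * c * x + s * e := by
      rw [← hcx]
      have := mul_le_mul_of_nonneg_left h1 hs0
      linarith
    have h4 : (((s : ℝ) + 1) * x) ^ 2 ≤ y * ((s + 1) * c * x) + s * e := by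
      have := mul_le_mul_of_nonneg_left h3 hy0
      have h5 : y * (s * e) ≤ s * e := mul_le_of_le_one_left (by positivity) hy1
      linarith
    have hxη : η < (s + 1) * x := by
      have : 0 ≤ c * y := by positivity
      linarith
    have h6 : (c * y + η) * ((s + 1) * x) < ((s + 1) * x) ^ 2 := by
      rw [sq]; exact mul_lt_mul_of_pos_right hlt (by linarith)
    have h7 : η * η ≤ η * ((s + 1) * x) := mul_le_mul_of_nonneg_left hxη.le hη.le
    have h8 : s * e ≤ η ^ 2 := by linarith
    linarith

/-- The normalised number of `s`-cliques is at most that of the Turán graph, relative to edges. -/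
lemma le_of_moon_moser (ℓ : ℕ) (s : ℕ) (hs2 : 2 ≤ s) : s ≤ ℓ →
    ∀ η : ℝ, 0 < η → ∃ γ > 0, ∀ b : ℕ → ℝ, (∀ i, 0 ≤ b i) → (∀ i, b i ≤ 1) →
      (∀ i : ℕ, (((i : ℝ) + 1) * b (i + 1)) ^ 2 ≤
        b i * (i * ((i + 2) * b (i + 2)) + b (i + 1))) →
      b (ℓ + 1) ≤ γ →
      ((ℓ.choose 2 : ℝ) / ℓ ^ 2) * b s ≤ ((ℓ.choose s : ℝ) / ℓ ^ s) * b 2 + η := by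
  induction s, hs2 using Nat.le_induction with
  | base =>
    intro _ η hη
    exact ⟨1, one_pos, fun b _ _ _ _ => by linarith⟩
  | succ s hs ih =>
    intro hsℓ η hη
    have hℓ : 0 < ℓ := by omega
    have hℓ' : (0 : ℝ) < ℓ := by exact_mod_cast hℓ
    obtain ⟨γ₁, hγ₁, h₁⟩ := ih (by omega) (η / 2) (by positivity)
    obtain ⟨γ₂, hγ₂, h₂⟩ := ratio_le_of_moon_moser ℓ hℓ (ℓ - s) s (by omega) (η / 2)
      (by positivity)
    refine ⟨min γ₁ γ₂, lt_min hγ₁ hγ₂, fun b hb0 hb1 hM hb => ?_⟩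
    have h1 := h₁ b hb0 hb1 hM (hb.trans (min_le_left _ _))
    have h2 := h₂ b hb0 hb1 hM (hb.trans (min_le_right _ _))
    have hch : ((ℓ.choose (s + 1) : ℝ)) * (s + 1) = ℓ.choose s * (ℓ - s) := by
      have := Nat.choose_succ_right_eq ℓ s
      have h' : ((ℓ - s : ℕ) : ℝ) = ℓ - s := by rw [Nat.cast_sub (by omega)]
      rw [← h']
      exact_mod_cast this
    have hT : ((ℓ.choose (s + 1) : ℝ) / ℓ ^ (s + 1)) * (s + 1) =
        ((ℓ.choose s : ℝ) / ℓ ^ s) * ((ℓ - s : ℝ) / ℓ) := by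
      rw [div_mul_eq_mul_div, hch, pow_succ]
      field_simp
    have hT2 : ((ℓ.choose 2 : ℝ) / ℓ ^ 2) ≤ 1 := by
      rw [div_le_one (by positivity)]
      exact_mod_cast Nat.choose_le_pow ℓ 2
    have hT0 : 0 ≤ ((ℓ.choose 2 : ℝ) / ℓ ^ 2) := by positivity
    have hr0 : 0 ≤ (ℓ - s : ℝ) / ℓ := by
      refine div_nonneg ?_ hℓ'.le
      have : (s : ℝ) ≤ ℓ := by exact_mod_cast (by omega : s ≤ ℓ)
      linarith
    have hr1 : (ℓ - s : ℝ) / ℓ ≤ 1 := by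
      rw [div_le_one hℓ']
      have : (0 : ℝ) ≤ s := Nat.cast_nonneg s
      linarith
    set T2 := ((ℓ.choose 2 : ℝ) / ℓ ^ 2)
    set c := (ℓ - s : ℝ) / ℓ
    set Ts := ((ℓ.choose s : ℝ) / ℓ ^ s)
    set T' := ((ℓ.choose (s + 1) : ℝ) / ℓ ^ (s + 1))
    have hs1 : (1 : ℝ) ≤ s + 1 := by
      have : (0 : ℝ) ≤ s := Nat.cast_nonneg s
      linarith
    refine le_of_mul_le_mul_left ?_ (by linarith : (0 : ℝ) < s + 1)
    have h3 := mul_le_mul_of_nonneg_left h2 hT0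
    have h4 := mul_le_mul_of_nonneg_left h1 hr0
    have h5 : T2 * (η / 2) ≤ η / 2 := mul_le_of_le_one_left (by positivity) hT2
    have h6 : c * (η / 2) ≤ η / 2 := mul_le_of_le_one_left (by positivity) hr1
    have h7 : 1 * η ≤ (s + 1) * η := mul_le_mul_of_nonneg_right hs1 hη.le
    have h8 : ((s : ℝ) + 1) * (T' * b 2 + η) = Ts * c * b 2 + (s + 1) * η := by
      rw [← hT]; ring
    rw [h8]
    nlinarith

lemma choose_mul_pow_le_card_cliqueFinset {n ℓ : ℕ} (hℓ : 0 < ℓ) (G : SimpleGraph (Fin n))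
    (hG : G = SimpleGraph.turanGraph n ℓ) (s : ℕ) (hs : s ≤ ℓ) :
    (ℓ.choose s : ℝ) * ((n / ℓ : ℕ) : ℝ) ^ s ≤ (G.cliqueFinset s).card := by
  induction s with
  | zero =>
    have : 0 < (G.cliqueFinset 0).card := card_pos.2 ⟨∅, by simp⟩
    simpa using this
  | succ s ih =>
    have ih := ih (by omega)
    have hch : ((ℓ.choose (s + 1) : ℝ)) * (s + 1) = ℓ.choose s * (ℓ - s : ℕ) := by
      exact_mod_cast Nat.choose_succ_right_eq ℓ s
    have h1 := sum_card_commonNbrs G s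
    have h2 : ∀ D ∈ G.cliqueFinset s, (((ℓ - s) * (n / ℓ) : ℕ) : ℝ) ≤
        ((commonNbrs G D).card : ℝ) := by
      intro D hD
      rw [SimpleGraph.mem_cliqueFinset_iff] at hD
      norm_cast
      set R := D.image fun v : Fin n => v.val % ℓ
      have hR : ℓ - s ≤ (range ℓ \ R).card := by
        have h3 := le_card_sdiff R (range ℓ)
        have h4 : R.card ≤ s := card_image_le.trans hD.card_eq.le
        rw [card_range] at h3
        omega
      calc (ℓ - s) * (n / ℓ) ≤ (range ℓ \ R).card * (range (n / ℓ)).card := by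
            rw [card_range]; exact Nat.mul_le_mul_right _ hR
        _ = ((range ℓ \ R) ×ˢ range (n / ℓ)).card := (card_product _ _).symm
        _ ≤ ((commonNbrs G D).image fun v : Fin n => (v.val % ℓ, v.val / ℓ)).card := by
            refine card_le_card fun p hp => ?_
            obtain ⟨j, q⟩ := p
            simp only [mem_product, mem_sdiff, mem_range] at hp
            obtain ⟨⟨hj, hjR⟩, hq⟩ := hp
            have hlt : j + ℓ * q < n := by
              calc j + ℓ * q < ℓ * (q + 1) := by rw [mul_add]; omega
                _ ≤ ℓ * (n / ℓ) := Nat.mul_le_mul_left _ hq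
                _ ≤ n := Nat.mul_div_le n ℓ
            have hmod : (j + ℓ * q) % ℓ = j := by
              rw [Nat.add_mul_mod_self_left, Nat.mod_eq_of_lt hj]
            refine mem_image.2 ⟨⟨j + ℓ * q, hlt⟩, ?_, ?_⟩
            · rw [mem_commonNbrs]
              intro u hu
              rw [hG, SimpleGraph.turanGraph_adj]
              simp only [hmod]
              rintro rfl
              exact hjR (mem_image.2 ⟨u, hu, rfl⟩)
            · simp only [hmod, Prod.mk.injEq, true_and]
              rw [Nat.add_mul_div_left _ _ hℓ, Nat.div_eq_of_lt hj, zero_add]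
        _ ≤ _ := card_image_le
    have h3 := sum_le_sum h2
    rw [h1, sum_const, nsmul_eq_mul] at h3
    refine le_of_mul_le_mul_left ?_ (by positivity : (0 : ℝ) < s + 1)
    refine le_trans ?_ h3
    push_cast
    calc ((s : ℝ) + 1) * (ℓ.choose (s + 1) * ((n / ℓ : ℕ) : ℝ) ^ (s + 1))
        = (ℓ.choose (s + 1) * ((s : ℝ) + 1)) * (((n / ℓ : ℕ) : ℝ) ^ s * ((n / ℓ : ℕ) : ℝ)) := by
          ring
      _ = (ℓ.choose s * ((n / ℓ : ℕ) : ℝ) ^ s) * ((ℓ - s : ℕ) * ((n / ℓ : ℕ) : ℝ)) := by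
          rw [hch]; ring
      _ ≤ _ := mul_le_mul_of_nonneg_right ih (by positivity)

lemma turanCount_eq_card_cliqueFinset (n ℓ r : ℕ) (G : SimpleGraph (Fin n))
    (hG : G = SimpleGraph.turanGraph n ℓ) : turanCount n ℓ r = (G.cliqueFinset r).card := by
  unfold turanCount
  congr 1
  ext A
  rw [SimpleGraph.mem_cliqueFinset_iff, SimpleGraph.isNClique_iff, hG]
  simp only [mem_filter, mem_univ, true_and, SimpleGraph.isClique_iff, Set.Pairwise,
    SimpleGraph.turanGraph_adj, mem_coe, and_comm]

lemma le_turanCount {n ℓ r : ℕ} (hℓ : 0 < ℓ) (hr : r ≤ ℓ) (hn : ℓ ≤ n) :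
    ((ℓ.choose r : ℝ) / ℓ ^ r) * (n : ℝ) ^ r * (1 - r * ℓ / n) ≤ turanCount n ℓ r := by
  rw [turanCount_eq_card_cliqueFinset n ℓ r _ rfl]
  refine le_trans ?_ (choose_mul_pow_le_card_cliqueFinset hℓ _ rfl r hr)
  have hℓ' : (0 : ℝ) < ℓ := by exact_mod_cast hℓ
  have hn' : (ℓ : ℝ) ≤ n := by exact_mod_cast hn
  have hn0 : (0 : ℝ) < n := by linarith
  have h1 : (n : ℝ) / ℓ * (1 - ℓ / n) ≤ ((n / ℓ : ℕ) : ℝ) := by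
    have h2 : (n : ℝ) / ℓ < ((n / ℓ : ℕ) : ℝ) + 1 := by
      rw [div_lt_iff₀ hℓ']
      have := Nat.lt_div_mul_add (a := n) hℓ
      have h3 : n < (n / ℓ + 1) * ℓ := by rw [add_mul, one_mul]; exact this
      exact_mod_cast h3
    have h3 : (n : ℝ) / ℓ * (1 - ℓ / n) = n / ℓ - 1 := by field_simp
    linarith
  have h0 : (0 : ℝ) ≤ 1 - ℓ / n := by
    rw [sub_nonneg, div_le_one hn0]; exact hn'
  have h2 : 1 - r * ℓ / n ≤ (1 - (ℓ : ℝ) / n) ^ r := by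
    have := one_add_mul_le_pow (a := -((ℓ : ℝ) / n)) (by linarith) r
    calc 1 - r * ℓ / n = 1 + r * (-((ℓ : ℝ) / n)) := by ring
      _ ≤ _ := this
      _ = _ := by ring
  calc ((ℓ.choose r : ℝ) / ℓ ^ r) * (n : ℝ) ^ r * (1 - r * ℓ / n)
      ≤ ((ℓ.choose r : ℝ) / ℓ ^ r) * (n : ℝ) ^ r * (1 - (ℓ : ℝ) / n) ^ r :=
        mul_le_mul_of_nonneg_left h2 (by positivity)
    _ = ℓ.choose r * (n / ℓ * (1 - ℓ / n)) ^ r := by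
        rw [mul_pow, div_pow]; ring
    _ ≤ _ := by
        refine mul_le_mul_of_nonneg_left (pow_le_pow_left₀ ?_ h1 r) (by positivity)
        positivity

lemma descFactorial_le_card_filter_embedding {n : ℕ} (S : Finset (Fin n)) (t : ℕ) :
    S.card.descFactorial t ≤ ((univ : Finset (Fin t ↪ Fin n)).filter fun τ => ∀ j, τ j ∈ S).card := by
  have h : Fintype.card (Fin t ↪ S) = S.card.descFactorial t := by
    rw [Fintype.card_embedding_eq, Fintype.card_fin, Fintype.card_coe]
  rw [← h, ← card_univ]
  refine card_le_card_of_injOn (fun τ => τ.trans (Function.Embedding.subtype _)) ?_ ?_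
  · intro τ _
    simp
  · intro τ _ σ _ h
    ext j
    have := DFunLike.congr_fun h j
    simpa using congrArg Fin.val this

lemma sum_card_fiber_cons {n s : ℕ} (E : Finset (Fin (s + 1) → Fin n)) :
    ∑ y : Fin s → Fin n, (univ.filter fun x : Fin n => Fin.cons x y ∈ E).card = E.card := by
  rw [← card_sigma]
  refine card_bij (fun p _ => Fin.cons p.2 p.1) ?_ ?_ ?_
  · rintro ⟨y, x⟩ h
    simpa using h
  · rintro ⟨y, x⟩ _ ⟨y', x'⟩ _ h
    obtain ⟨rfl, rfl⟩ := Fin.cons_injective2 h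
    rfl
  · intro z hz
    refine ⟨⟨Fin.tail z, z 0⟩, ?_, ?_⟩
    · simpa using hz
    · simp

lemma sum_card_embedding_fiber_cons {n s : ℕ} (t : ℕ) (E : Finset (Fin (s + 1) → Fin n)) :
    ∑ y : Fin s → Fin n, ((univ.filter fun x : Fin n => Fin.cons x y ∈ E).card + 1 - t) ^ t ≤
      ∑ τ : Fin t ↪ Fin n, (univ.filter fun y : Fin s → Fin n =>
        ∀ j, Fin.cons (τ j) y ∈ E).card := by
  have h1 := sum_card_bipartiteAbove_eq_sum_card_bipartiteBelow
      (r := fun (τ : Fin t ↪ Fin n) (y : Fin s → Fin n) =>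
        ∀ j, (Fin.cons (τ j) y : Fin (s + 1) → Fin n) ∈ E)
      (s := univ) (t := univ)
  simp only [bipartiteAbove, bipartiteBelow] at h1
  rw [h1]
  refine sum_le_sum fun y _ => ?_
  refine (Nat.pow_sub_le_descFactorial _ t).trans ?_
  refine (descFactorial_le_card_filter_embedding _ t).trans (le_of_eq ?_)
  simp only [mem_filter, mem_univ, true_and]

/-- The averaging step in the proof that dense sets of tuples contain boxes. -/
lemma exists_embedding_fiber_cons {n s t : ℕ} (ht : 0 < t) {γ : ℝ} (hγ : 0 < γ) (hn : 0 < n)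
    (hnt : 2 * t / γ ≤ n) (E : Finset (Fin (s + 1) → Fin n))
    (hE : γ * (n : ℝ) ^ (s + 1) ≤ E.card) :
    ∃ τ : Fin t ↪ Fin n, (γ / 2) ^ t * (n : ℝ) ^ s ≤
      ((univ.filter fun y : Fin s → Fin n => ∀ j, Fin.cons (τ j) y ∈ E).card : ℝ) := by
  have hn0 : (0 : ℝ) < n := by exact_mod_cast hn
  have hsum := sum_card_fiber_cons E
  have hdc := sum_card_embedding_fiber_cons t E
  generalize hd : (fun y : Fin s → Fin n =>
    (univ.filter fun x : Fin n => Fin.cons x y ∈ E).card) = d at hsum hdc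
  have hd' : ∀ y, (univ.filter fun x : Fin n => Fin.cons x y ∈ E).card = d y :=
    fun y => congrFun hd y
  simp only [hd'] at hsum hdc
  generalize hY : (fun τ : Fin t ↪ Fin n => (univ.filter fun y : Fin s → Fin n =>
    ∀ j, Fin.cons (τ j) y ∈ E).card) = Y at hdc
  have hY' : ∀ τ : Fin t ↪ Fin n, (univ.filter fun y : Fin s → Fin n =>
    ∀ j, Fin.cons (τ j) y ∈ E).card = Y τ := fun τ => congrFun hY τ
  simp only [hY'] at hdc ⊢
  have hN : (univ : Finset (Fin s → Fin n)).card = n ^ s := by simp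
  have hsum : (∑ y, (d y : ℝ)) = E.card := by exact_mod_cast hsum
  have hlow : γ / 2 * n ^ (s + 1) ≤ ∑ y, max ((d y : ℝ) - t) 0 := by
    have h1 : ∑ y, ((d y : ℝ) - t) ≤ ∑ y, max ((d y : ℝ) - t) 0 :=
      sum_le_sum fun y _ => le_max_left _ _
    rw [sum_sub_distrib, hsum, sum_const, hN, nsmul_eq_mul] at h1
    push_cast at h1
    have h2 : (t : ℝ) ≤ γ / 2 * n := by
      rw [div_le_iff₀ hγ] at hnt
      linarith
    have h3 := mul_le_mul_of_nonneg_left h2 (by positivity : (0 : ℝ) ≤ n ^ s)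
    rw [pow_succ] at hE ⊢
    linarith
  have hdc : (γ / 2) ^ t * n ^ s * n ^ t ≤ ∑ τ, (Y τ : ℝ) := by
    have h2 : ∑ y, max ((d y : ℝ) - t) 0 ^ t ≤ ∑ τ, (Y τ : ℝ) := by
      refine le_trans ?_ (Nat.cast_le (α := ℝ).2 hdc |>.trans (by push_cast; exact le_rfl))
      push_cast
      refine sum_le_sum fun y _ => ?_
      refine pow_le_pow_left₀ (le_max_right _ _) ?_ _
      refine max_le ?_ (Nat.cast_nonneg _)
      have : d y ≤ (d y + 1 - t) + t := by omega
      have : (d y : ℝ) ≤ ((d y + 1 - t : ℕ) : ℝ) + t := by exact_mod_cast this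
      linarith
    refine le_trans ?_ h2
    obtain ⟨k, rfl⟩ : ∃ k, t = k + 1 := ⟨t - 1, by omega⟩
    refine le_trans ?_ (pow_sum_div_card_le_sum_pow (fun y _ => le_max_right _ _) k)
    rw [hN, le_div_iff₀ (by positivity)]
    refine le_trans (le_of_eq ?_) (pow_le_pow_left₀ (by positivity) hlow (k + 1))
    push_cast
    ring
  have hne : (univ : Finset (Fin t ↪ Fin n)).Nonempty := by
    rw [nonempty_iff_ne_empty]
    intro h
    rw [h, sum_empty] at hdc
    have : 0 < (γ / 2) ^ t * (n : ℝ) ^ s * n ^ t := by positivity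
    linarith
  obtain ⟨τ, -, hτ⟩ : ∃ τ ∈ (univ : Finset (Fin t ↪ Fin n)),
      (γ / 2) ^ t * (n : ℝ) ^ s ≤ (Y τ : ℝ) := by
    refine exists_le_of_sum_le hne (le_trans ?_ hdc)
    rw [sum_const, nsmul_eq_mul, mul_comm]
    refine mul_le_mul_of_nonneg_left ?_ (by positivity)
    rw [card_univ, Fintype.card_embedding_eq, Fintype.card_fin, Fintype.card_fin]
    exact_mod_cast Nat.descFactorial_le_pow n t
  exact ⟨τ, hτ⟩

/-- A dense set of `s`-tuples contains a box with sides of size `t`. -/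
lemma exists_box (t s : ℕ) : ∀ γ : ℝ, 0 < γ → ∃ n₀ : ℕ, ∀ n : ℕ, n₀ ≤ n →
    ∀ E : Finset (Fin s → Fin n), γ * (n : ℝ) ^ s ≤ E.card →
      ∃ A : Fin s → (Fin t ↪ Fin n), ∀ p : Fin s → Fin t, (fun i => A i (p i)) ∈ E := by
  induction s with
  | zero =>
    intro γ hγ
    refine ⟨0, fun n _ E hE => ⟨fun i => i.elim0, fun p => ?_⟩⟩
    have : 0 < E.card := by
      have : (0 : ℝ) < E.card := by
        rw [pow_zero, mul_one] at hE
        linarith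
      exact_mod_cast this
    obtain ⟨x, hx⟩ := card_pos.1 this
    convert hx
  | succ s ih =>
    intro γ hγ
    obtain ⟨n₁, h₁⟩ := ih ((γ / 2) ^ t) (by positivity)
    refine ⟨max (max n₁ 1) ⌈2 * t / γ⌉₊, fun n hn E hE => ?_⟩
    have hn1 : n₁ ≤ n := (le_max_left _ _).trans ((le_max_left _ _).trans hn)
    have hn2 : 1 ≤ n := (le_max_right _ _).trans ((le_max_left _ _).trans hn)
    have hn3 : 2 * t / γ ≤ n := Nat.ceil_le.1 ((le_max_right _ _).trans hn)
    rcases Nat.eq_zero_or_pos t with rfl | ht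
    · exact ⟨fun _ => ⟨fun i => i.elim0, fun i => i.elim0⟩, fun p => (p 0).elim0⟩
    obtain ⟨τ, hτ⟩ := exists_embedding_fiber_cons ht hγ hn2 hn3 E hE
    obtain ⟨A, hA⟩ := h₁ n hn1 _ hτ
    refine ⟨Fin.cons τ A, fun p => ?_⟩
    have h := hA fun i => p i.succ
    simp only [mem_filter, mem_univ, true_and] at h
    convert h (p 0) using 1
    funext i
    refine Fin.cases ?_ (fun i => ?_) i <;> simp

/-- The `k`-tuples of pairwise adjacent vertices of `U`. -/
noncomputable def cliqueTuples (G : SimpleGraph V) (k : ℕ) (U : Finset V) : Finset (Fin k → V) :=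
  univ.filter fun t => (∀ i, t i ∈ U) ∧ ∀ i j, i ≠ j → G.Adj (t i) (t j)

lemma mem_cliqueTuples {G : SimpleGraph V} {k : ℕ} {U : Finset V} {t : Fin k → V} :
    t ∈ cliqueTuples G k U ↔ (∀ i, t i ∈ U) ∧ ∀ i j, i ≠ j → G.Adj (t i) (t j) := by
  simp [cliqueTuples]

lemma card_cliqueTuples_lt_of_colorable {W : Type*} [Fintype W] (H : SimpleGraph W) (k : ℕ)
    (hH : H.Colorable k) (γ : ℝ) (hγ : 0 < γ) :
    ∃ n₀ : ℕ, ∀ n : ℕ, n₀ ≤ n → ∀ G : SimpleGraph (Fin n),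
      (¬ ∃ φ : W ↪ Fin n, ∀ a b : W, H.Adj a b → G.Adj (φ a) (φ b)) →
      ((cliqueTuples G k univ).card : ℝ) < γ * (n : ℝ) ^ k := by
  obtain ⟨n₀, h₀⟩ := exists_box (Fintype.card W) k γ hγ
  refine ⟨n₀, fun n hn G hG => ?_⟩
  by_contra! hlt
  obtain ⟨A, hA⟩ := h₀ n hn _ hlt
  obtain ⟨c⟩ := hH
  let e := Fintype.equivFin W
  have key : ∀ a b : W, c a ≠ c b → G.Adj (A (c a) (e a)) (A (c b) (e b)) := by
    intro a b hab
    have h := (mem_cliqueTuples.1 (hA fun i => if i = c a then e a else e b)).2 _ _ hab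
    simpa [hab.symm] using h
  refine hG ⟨⟨fun w => A (c w) (e w), fun a b hab => ?_⟩, fun a b hab => key a b (c.valid hab)⟩
  by_cases hc : c a = c b
  · simp only [hc] at hab
    exact e.injective ((A (c b)).injective hab)
  · have := key a b hc
    simp only at hab
    rw [hab] at this
    exact absurd this (G.loopless.irrefl _)

lemma card_cliqueFinset_le_card_cliqueTuples (G : SimpleGraph V) (k : ℕ) :
    (G.cliqueFinset k).card ≤ (cliqueTuples G k univ).card := by
  refine card_le_card_of_surjOn (fun t => univ.image t) ?_
  intro A hA
  rw [mem_coe, SimpleGraph.mem_cliqueFinset_iff] at hA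
  let e := A.equivFinOfCardEq hA.card_eq
  refine ⟨fun i => (e.symm i : V), ?_, ?_⟩
  · rw [mem_coe, mem_cliqueTuples]
    refine ⟨fun _ => mem_univ _, fun i j hij => ?_⟩
    refine hA.isClique (e.symm i).2 (e.symm j).2 fun h => hij ?_
    exact e.symm.injective (Subtype.ext h)
  · ext v
    simp only [mem_image, mem_univ, true_and]
    constructor
    · rintro ⟨i, rfl⟩
      exact (e.symm i).2
    · intro hv
      exact ⟨e ⟨v, hv⟩, by simp⟩

lemma mul_le_card_cliqueTuples_succ (G : SimpleGraph V) (k c : ℕ) (U S : Finset V) (hS : S ⊆ U)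
    (h : ∀ x ∈ S, c ≤ (cliqueTuples G k (U.filter (G.Adj x))).card) :
    S.card * c ≤ (cliqueTuples G (k + 1) U).card := by
  calc S.card * c = ∑ _x ∈ S, c := by rw [sum_const, smul_eq_mul]
    _ ≤ ∑ x ∈ S, (cliqueTuples G k (U.filter (G.Adj x))).card := sum_le_sum h
    _ = (S.sigma fun x => cliqueTuples G k (U.filter (G.Adj x))).card := (card_sigma _ _).symm
    _ ≤ _ := by
      refine card_le_card_of_injOn (fun p => Fin.cons p.1 p.2) ?_ ?_
      · rintro ⟨x, t⟩ hp
        simp only [mem_coe, mem_sigma, mem_cliqueTuples, mem_filter] at hp ⊢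
        obtain ⟨hx, h1, h2⟩ := hp
        refine ⟨fun i => ?_, fun i j => ?_⟩
        · refine Fin.cases (hS hx) (fun i => ?_) i
          simpa using (h1 i).1
        · refine Fin.cases ?_ (fun i => ?_) i <;> refine Fin.cases ?_ (fun j => ?_) j
          · simp
          · intro _
            simpa using (h1 j).2
          · intro _
            simpa using (h1 i).2.symm
          · intro hij
            simpa using h2 i j fun h => hij (by rw [h])
      · rintro ⟨x, t⟩ _ ⟨x', t'⟩ _ hp
        obtain ⟨rfl, rfl⟩ := Fin.cons_injective2 hp
        rfl

lemma card_cliqueFinset_two_le (G : SimpleGraph V) :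
    (G.cliqueFinset 2).card ≤ G.edgeFinset.card := by
  refine card_le_card_of_surjOn (fun e => univ.filter (· ∈ e)) ?_
  intro A hA
  rw [mem_coe, SimpleGraph.mem_cliqueFinset_iff] at hA
  obtain ⟨x, y, hxy, rfl⟩ := card_eq_two.1 hA.card_eq
  refine ⟨s(x, y), ?_, ?_⟩
  · rw [mem_coe, SimpleGraph.mem_edgeFinset, SimpleGraph.mem_edgeSet]
    exact hA.isClique (by simp) (by simp) hxy
  · ext v
    simp

lemma adjCount_self_le_card_cliqueTuples (G : SimpleGraph V) (U : Finset V) :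
    adjCount G U U ≤ (cliqueTuples G 2 U).card := by
  have h : ∑ x ∈ U, (U.filter (G.Adj x)).card = (U.sigma fun x => U.filter (G.Adj x)).card :=
    (card_sigma _ _).symm
  have h2 : (U.sigma fun x => U.filter (G.Adj x)).card ≤ (cliqueTuples G 2 U).card := by
    refine card_le_card_of_injOn (fun p => ![p.1, p.2]) ?_ ?_
    · rintro ⟨x, y⟩ hp
      simp only [mem_coe, mem_sigma, mem_filter, mem_cliqueTuples] at hp ⊢
      refine ⟨fun i => ?_, fun i j hij => ?_⟩
      · fin_cases i
        · exact hp.1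
        · exact hp.2.1
      · fin_cases i <;> fin_cases j
        · exact absurd rfl hij
        · exact hp.2.2
        · exact hp.2.2.symm
        · exact absurd rfl hij
    · rintro ⟨x, y⟩ _ ⟨x', y'⟩ _ hp
      have h0 := congrFun hp 0
      have h1 := congrFun hp 1
      simp only [Matrix.cons_val_zero, Matrix.cons_val_one] at h0 h1
      subst h0 h1
      rfl
  rw [← h] at h2
  unfold adjCount
  exact_mod_cast h2

/-- A robust form of Füredi's stability argument: a vertex set spanning few cliques on `k + 2`
vertices has a partition into `k + 1` classes for which the edges plus the edges inside the classes
number at most the Turán bound, up to a small error. -/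
lemma exists_partition_adjCount_le (G : SimpleGraph V) (m : ℕ) (hm : m ≤ Fintype.card V) (k : ℕ) :
    ∀ U : Finset V, (cliqueTuples G (k + 2) U).card < m ^ (k + 2) →
      ∃ f : V → Fin (k + 1), adjCount G U U + adjCount (withinClasses G f) U U ≤
        (k / (k + 1) : ℝ) * (U.card : ℝ) ^ 2 + 2 * m * Fintype.card V * (k + 1) := by
  have hmn : (m : ℝ) ≤ Fintype.card V := by exact_mod_cast hm
  have hm0 : (0 : ℝ) ≤ m := Nat.cast_nonneg m
  have hmm : (m : ℝ) * m ≤ m * Fintype.card V := mul_le_mul_of_nonneg_left hmn hm0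
  have hle : ∀ {k : ℕ} (f : V → Fin (k + 1)) (U : Finset V),
      adjCount (withinClasses G f) U U ≤ adjCount G U U :=
    fun f U => adjCount_mono fun x _ y _ h => h.1
  induction k with
  | zero =>
    intro U hU
    refine ⟨fun _ => 0, ?_⟩
    have h1 := adjCount_self_le_card_cliqueTuples G U
    have h2 : ((cliqueTuples G 2 U).card : ℝ) ≤ m * m := by
      have : (cliqueTuples G 2 U).card ≤ m ^ 2 := hU.le
      rw [sq] at this
      exact_mod_cast this
    have h3 := hle (fun _ => (0 : Fin (0 + 1))) U
    push_cast
    simp only [zero_div, zero_mul, zero_add, mul_one]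
    linarith
  | succ k ih =>
    intro U hU
    set N : ℝ := (Fintype.card V : ℝ) with hN
    set bad := U.filter fun x => m ^ (k + 2) ≤ (cliqueTuples G (k + 2) (U.filter (G.Adj x))).card
      with hbad
    have hbadm : bad.card < m := by
      have h1 := mul_le_card_cliqueTuples_succ G (k + 2) (m ^ (k + 2)) U bad (filter_subset _ _)
        fun x hx => (mem_filter.1 hx).2
      by_contra! h2
      have h3 := Nat.mul_le_mul_right (m ^ (k + 2)) h2
      have h4 : m ^ (k + 1 + 2) = m * m ^ (k + 2) := by ring
      have h5 : m * m ^ (k + 2) ≤ (cliqueTuples G (k + 1 + 2) U).card := h3.trans h1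
      omega
    have hk0 : (0 : ℝ) ≤ k := Nat.cast_nonneg k
    have hmN : 0 ≤ (m : ℝ) * N := mul_nonneg hm0 (hm0.trans hmn)
    by_cases hgood : (U \ bad).Nonempty
    · obtain ⟨x, hx, hmax⟩ := exists_max_image (U \ bad) (fun v => (U.filter (G.Adj v)).card) hgood
      rw [mem_sdiff] at hx
      set U' := U.filter (G.Adj x) with hU'
      set A := U.filter (fun v => ¬ G.Adj x v) with hA
      have hcl : (cliqueTuples G (k + 2) U').card < m ^ (k + 2) := by
        by_contra! h
        exact hx.2 (mem_filter.2 ⟨hx.1, h⟩)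
      obtain ⟨f', hf'⟩ := ih U' hcl
      have hdisj : Disjoint A U' := (disjoint_filter_filter_not U U (G.Adj x)).symm
      have hunion : A ∪ U' = U := by
        rw [union_comm]; exact filter_union_filter_not_eq _ _
      let f : V → Fin (k + 1 + 1) := fun v => if G.Adj x v then (f' v).succ else 0
      refine ⟨f, ?_⟩
      have hfA : ∀ v ∈ A, f v = 0 := fun v hv => if_neg (mem_filter.1 hv).2
      have hfU : ∀ v ∈ U', f v = (f' v).succ := fun v hv => if_pos (mem_filter.1 hv).2
      have e1 : adjCount G U U = 2 * adjCount G A U - adjCount G A A + adjCount G U' U' := by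
        rw [← hunion, adjCount_union_left G hdisj, adjCount_union_right G A hdisj,
          adjCount_union_right G U' hdisj, adjCount_comm G U' A]
        ring
      have e2 : adjCount (withinClasses G f) U U ≤
          adjCount G A A + adjCount (withinClasses G f') U' U' := by
        have z : adjCount (withinClasses G f) A U' = 0 := by
          refine adjCount_eq_zero fun a ha b hb h => ?_
          have := h.2
          rw [hfA a ha, hfU b hb] at this
          exact Fin.succ_ne_zero _ this.symm
        rw [← hunion, adjCount_union_left _ hdisj, adjCount_union_right _ A hdisj,
          adjCount_union_right _ U' hdisj, adjCount_comm _ U' A, z]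
        have h1 := hle f A
        have h2 : adjCount (withinClasses G f) U' U' ≤ adjCount (withinClasses G f') U' U' := by
          refine adjCount_mono fun a ha b hb h => ⟨h.1, ?_⟩
          have := h.2
          rw [hfU a ha, hfU b hb] at this
          exact Fin.succ_injective _ this
        linarith
      have e3 : adjCount G A U ≤ A.card * U'.card + m * N := by
        have h1 : ∀ v ∈ A, ((U.filter (G.Adj v)).card : ℝ) ≤
            U'.card + if v ∈ bad then N else 0 := by
          intro v hv
          split_ifs with hvb
          · have h2 : ((U.filter (G.Adj v)).card : ℝ) ≤ N := by
              rw [hN]; exact_mod_cast card_le_univ _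
            have : (0 : ℝ) ≤ U'.card := Nat.cast_nonneg _
            linarith
          · rw [add_zero]
            exact_mod_cast hmax v (mem_sdiff.2 ⟨(mem_filter.1 hv).1, hvb⟩)
        refine (sum_le_sum h1).trans ?_
        rw [sum_add_distrib, sum_const, nsmul_eq_mul, ← sum_filter, sum_const, nsmul_eq_mul]
        have h2 : ((A.filter (· ∈ bad)).card : ℝ) ≤ m := by
          have : (A.filter (· ∈ bad)).card ≤ bad.card :=
            card_le_card fun v hv => (mem_filter.1 hv).2
          exact_mod_cast this.trans hbadm.le
        have h3 := mul_le_mul_of_nonneg_right h2 (hm0.trans hmn)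
        linarith
      have e4 : (U.card : ℝ) = A.card + U'.card := by
        rw [← hunion, card_union_of_disjoint hdisj]
        push_cast
        rfl
      rw [e4]
      have e5 : (k / (k + 1) : ℝ) * (U'.card : ℝ) ^ 2 + 2 * (A.card * U'.card) ≤
          (((k + 1 : ℕ) : ℝ) / ((k + 1 : ℕ) + 1)) * (A.card + U'.card : ℝ) ^ 2 := by
        generalize (A.card : ℝ) = a
        generalize (U'.card : ℝ) = w
        push_cast
        have h : ((k + 1 : ℝ) / (k + 1 + 1)) * (a + w) ^ 2 -
            ((k / (k + 1) : ℝ) * w ^ 2 + 2 * (a * w)) =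
            ((k + 1) * a - w) ^ 2 / ((k + 1) * (k + 1 + 1)) := by
          field_simp
          ring
        have : 0 ≤ ((k + 1) * a - w) ^ 2 / (((k : ℝ) + 1) * (k + 1 + 1)) := by positivity
        linarith
      push_cast at e5 ⊢
      linarith
    · have hUm : U.card ≤ m := by
        rw [not_nonempty_iff_eq_empty, sdiff_eq_empty_iff_subset] at hgood
        exact (card_le_card hgood).trans hbadm.le
      refine ⟨fun _ => 0, ?_⟩
      have h1 := hle (fun _ => (0 : Fin (k + 1 + 1))) U
      have h2 := adjCount_le G U U
      have h3 : (U.card : ℝ) * U.card ≤ m * m := by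
        exact_mod_cast Nat.mul_le_mul hUm hUm
      have h4 : 0 ≤ (((k + 1 : ℕ) : ℝ) / ((k + 1 : ℕ) + 1)) * (U.card : ℝ) ^ 2 := by positivity
      push_cast at h4 ⊢
      have h5 : 0 ≤ (m : ℝ) * N * (k + 1) := mul_nonneg hmN (by linarith)
      linarith

lemma moon_moser_normalized (G : SimpleGraph V) {N : ℝ} (hN : N = Fintype.card V) (hN0 : 0 < N)
    (s : ℕ) :
    (((s : ℝ) + 1) * ((G.cliqueFinset (s + 1)).card / N ^ (s + 1))) ^ 2 ≤
      (G.cliqueFinset s).card / N ^ s * (s * ((s + 2) * ((G.cliqueFinset (s + 2)).card / N ^ (s + 2)))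
        + (G.cliqueFinset (s + 1)).card / N ^ (s + 1)) := by
  have h := moon_moser G s
  rw [← hN] at h
  generalize ((G.cliqueFinset s).card : ℝ) = k₀ at *
  generalize ((G.cliqueFinset (s + 1)).card : ℝ) = k₁ at *
  generalize ((G.cliqueFinset (s + 2)).card : ℝ) = k₂ at *
  have e1 : (((s : ℝ) + 1) * (k₁ / N ^ (s + 1))) ^ 2 = (((s : ℝ) + 1) * k₁) ^ 2 / N ^ (2 * s + 2) := by
    rw [← mul_div_assoc, div_pow, ← pow_mul]
    ring_nf
  have e2 : k₀ / N ^ s * (s * ((s + 2) * (k₂ / N ^ (s + 2))) + k₁ / N ^ (s + 1)) =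
      k₀ * (s * ((s + 2) * k₂) + N * k₁) / N ^ (2 * s + 2) := by
    field_simp
    ring
  rw [e1, e2]
  exact div_le_div_of_nonneg_right h (by positivity)

lemma card_filter_edgeFinset_le {α : Type*} (G : SimpleGraph V) (f : V → α) :
    (G.edgeFinset.filter fun e => ∃ x ∈ e, ∃ y ∈ e, x ≠ y ∧ f x = f y).card ≤
      (withinClasses G f).edgeFinset.card := by
  refine card_le_card fun e he => ?_
  rw [mem_filter, SimpleGraph.mem_edgeFinset] at he
  obtain ⟨hG, x, hx, y, hy, hxy, hf⟩ := he
  obtain rfl := (Sym2.mem_and_mem_iff hxy).1 ⟨hx, hy⟩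
  rw [SimpleGraph.mem_edgeFinset, SimpleGraph.mem_edgeSet]
  exact ⟨hG, hf⟩

end CliqueCounts

theorem stmt_18 (ℓ r : ℕ) (hr : 3 ≤ r) (hrℓ : r ≤ ℓ) (δ : ℝ) (hδ : 0 < δ)
    (W : Type) [Fintype W] (Hg : SimpleGraph W)
    (hchrom : Hg.chromaticNumber = (ℓ + 1 : ℕ∞)) :
    ∃ n₀ : ℕ, ∀ n : ℕ, n₀ ≤ n → ∀ G : SimpleGraph (Fin n),
      (¬ ∃ φ : W ↪ Fin n, ∀ a b : W, Hg.Adj a b → G.Adj (φ a) (φ b)) →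
      (1 - δ / 3) * (turanCount n ℓ r : ℝ) ≤ ((G.cliqueFinset r).card : ℝ) →
      ∃ f : Fin n → Fin ℓ,
        ((G.edgeFinset.filter fun e => ∃ x ∈ e, ∃ y ∈ e, x ≠ y ∧ f x = f y).card : ℝ)
          ≤ δ * (n : ℝ) ^ 2 := by
  obtain ⟨k, rfl⟩ : ∃ k, ℓ = k + 1 := ⟨ℓ - 1, by omega⟩
  have hcol : Hg.Colorable (k + 1 + 1) := by
    rw [← SimpleGraph.chromaticNumber_le_iff_colorable, hchrom]
    push_cast
    exact le_rfl
  set T₂ : ℝ := (((k + 1).choose 2 : ℕ) : ℝ) / ((k + 1 : ℕ) : ℝ) ^ 2 with hT₂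
  set Tᵣ : ℝ := (((k + 1).choose r : ℕ) : ℝ) / ((k + 1 : ℕ) : ℝ) ^ r with hTᵣ
  have hℓ0 : (0 : ℝ) < ((k + 1 : ℕ) : ℝ) := by positivity
  have hTᵣ0 : 0 < Tᵣ := by
    have : 0 < (k + 1).choose r := Nat.choose_pos hrℓ
    have : (0 : ℝ) < (((k + 1).choose r : ℕ) : ℝ) := by exact_mod_cast this
    positivity
  have hT₂k : 2 * T₂ = k / (k + 1) := by
    have : (((k + 1).choose 2 : ℕ) : ℝ) * 2 = (k + 1) * k := by
      have := Nat.choose_succ_right_eq (k + 1) 1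
      simp only [Nat.choose_one_right, add_tsub_cancel_right] at this
      exact_mod_cast this
    rw [hT₂, mul_div_assoc', mul_comm, this]
    push_cast
    field_simp
  have hT₂h : T₂ ≤ 1 / 2 := by
    have : (k : ℝ) / (k + 1) ≤ 1 := by
      rw [div_le_one (by positivity)]
      linarith
    linarith
  have hT₂0 : 0 ≤ T₂ := by positivity
  by_cases hδ1 : 1 ≤ δ
  · refine ⟨0, fun n _ G _ _ => ⟨fun _ => 0, ?_⟩⟩
    refine (Nat.cast_le.2 (card_filter_le _ _)).trans ?_
    have h1 := two_mul_card_edgeFinset G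
    have h2 := adjCount_le G univ univ
    rw [card_univ, Fintype.card_fin] at h2
    have h3 : 0 ≤ (δ - 1) * (n : ℝ) ^ 2 := mul_nonneg (by linarith) (sq_nonneg _)
    have h4 : (0 : ℝ) ≤ (G.edgeFinset.card : ℝ) := Nat.cast_nonneg _
    nlinarith
  push Not at hδ1
  obtain ⟨γ, hγ, hγb⟩ := le_of_moon_moser (k + 1) r (by omega) hrℓ (δ * Tᵣ / 6) (by positivity)
  set g : ℝ := δ / (12 * ((k + 1 : ℕ) : ℝ)) with hg
  have hg0 : 0 < g := by positivity
  have hgℓ : g * ((k + 1 : ℕ) : ℝ) = δ / 12 := by rw [hg]; field_simp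
  have hgh : 2 * g ≤ 1 := by
    have : g * 1 ≤ g * ((k + 1 : ℕ) : ℝ) :=
      mul_le_mul_of_nonneg_left (by push_cast; linarith [(Nat.cast_nonneg k : (0 : ℝ) ≤ k)]) hg0.le
    linarith
  obtain ⟨n₁, h₁⟩ := card_cliqueTuples_lt_of_colorable Hg (k + 1 + 1) hcol
    (min γ (g ^ (k + 1 + 1))) (by positivity)
  refine ⟨max (max n₁ (k + 1)) (max ⌈6 * (r * ((k + 1 : ℕ) : ℝ)) / δ⌉₊ ⌈1 / g⌉₊),
    fun n hn G hG hcount => ?_⟩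
  simp only [max_le_iff, Nat.ceil_le] at hn
  obtain ⟨⟨hn1, hnℓ⟩, hnδ, hng⟩ := hn
  have hn0 : (0 : ℝ) < n := by exact_mod_cast (by omega : 0 < n)
  have htup := h₁ n hn1 G hG
  rw [div_le_iff₀ hδ] at hnδ
  rw [div_le_iff₀ hg0] at hng
  have hρ : (r : ℝ) * ((k + 1 : ℕ) : ℝ) / n ≤ δ / 6 := by
    rw [div_le_iff₀ hn0]
    linarith
  set b : ℕ → ℝ := fun s => ((G.cliqueFinset s).card : ℝ) / (n : ℝ) ^ s with hb
  have hedge : T₂ - 5 / 12 * δ ≤ b 2 := by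
    have hb1 : ∀ i, b i ≤ 1 := by
      intro i
      simp only [hb]
      rw [div_le_one (by positivity)]
      have h1 : (cliqueTuples G i univ).card ≤ n ^ i :=
        (card_le_univ _).trans (by simp)
      exact_mod_cast (card_cliqueFinset_le_card_cliqueTuples G i).trans h1
    have h2 := hγb b (fun i => by positivity) hb1
      (moon_moser_normalized G (by rw [Fintype.card_fin]) hn0) (by
        simp only [hb]
        rw [div_le_iff₀ (by positivity)]
        have h3 : ((G.cliqueFinset (k + 1 + 1)).card : ℝ) ≤
            (cliqueTuples G (k + 1 + 1) univ).card := by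
          exact_mod_cast card_cliqueFinset_le_card_cliqueTuples G _
        refine h3.trans (htup.le.trans ?_)
        exact mul_le_mul_of_nonneg_right (min_le_left _ _) (by positivity))
    have h3 := le_turanCount (Nat.succ_pos k) hrℓ hnℓ
    have h4 : (1 - δ / 3) * Tᵣ * (1 - δ / 6) ≤ b r := by
      simp only [hb]
      rw [le_div_iff₀ (by positivity)]
      refine le_trans ?_ hcount
      calc (1 - δ / 3) * Tᵣ * (1 - δ / 6) * (n : ℝ) ^ r
          = (1 - δ / 3) * (Tᵣ * n ^ r * (1 - δ / 6)) := by ring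
        _ ≤ (1 - δ / 3) * turanCount n (k + 1) r := by
          refine mul_le_mul_of_nonneg_left (le_trans ?_ h3) (by linarith)
          refine mul_le_mul_of_nonneg_left (by linarith) (by positivity)
    have h5 : T₂ * ((1 - δ / 3) * Tᵣ * (1 - δ / 6)) ≤ Tᵣ * b 2 + δ * Tᵣ / 6 :=
      (mul_le_mul_of_nonneg_left h4 hT₂0).trans h2
    have h6 : T₂ * ((1 - δ / 3) * (1 - δ / 6)) - δ / 6 ≤ b 2 := by
      refine le_of_mul_le_mul_left ?_ hTᵣ0
      linarith
    have h7 : T₂ * (1 - δ / 2) ≤ T₂ * ((1 - δ / 3) * (1 - δ / 6)) := by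
      refine mul_le_mul_of_nonneg_left ?_ hT₂0
      nlinarith [sq_nonneg δ]
    have h8 : T₂ * δ ≤ 1 / 2 * δ := mul_le_mul_of_nonneg_right hT₂h hδ.le
    linarith
  have hedges : (T₂ - 5 / 12 * δ) * (n : ℝ) ^ 2 ≤ (G.edgeFinset.card : ℝ) := by
    rw [← le_div_iff₀ (by positivity)]
    refine hedge.trans ?_
    simp only [hb]
    refine div_le_div_of_nonneg_right ?_ (by positivity)
    exact_mod_cast card_cliqueFinset_two_le G
  have hmle : (⌈g * n⌉₊ : ℝ) ≤ 2 * g * n := by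
    have := (Nat.ceil_lt_add_one (by positivity : 0 ≤ g * n)).le
    linarith
  have hmn : ⌈g * n⌉₊ ≤ Fintype.card (Fin n) := by
    rw [Fintype.card_fin, Nat.ceil_le]
    have := mul_le_mul_of_nonneg_right hgh hn0.le
    linarith [mul_pos hg0 hn0]
  have htup' : (cliqueTuples G (k + 2) univ).card < ⌈g * n⌉₊ ^ (k + 2) := by
    have h1 : ((cliqueTuples G (k + 2) univ).card : ℝ) < (⌈g * n⌉₊ : ℝ) ^ (k + 2) := by
      refine htup.trans_le ?_
      refine (mul_le_mul_of_nonneg_right (min_le_right _ _) (by positivity)).trans ?_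
      rw [← mul_pow]
      exact pow_le_pow_left₀ (by positivity) (Nat.le_ceil _) _
    exact_mod_cast h1
  obtain ⟨f, hf⟩ := exists_partition_adjCount_le G _ hmn k univ htup'
  refine ⟨f, ?_⟩
  refine le_trans (b := ((withinClasses G f).edgeFinset.card : ℝ)) (Nat.cast_le.2 ?_) ?_
  · convert card_filter_edgeFinset_le G f
  rw [← two_mul_card_edgeFinset, ← two_mul_card_edgeFinset, card_univ, Fintype.card_fin,
    ← hT₂k] at hf
  have herr : 2 * (⌈g * n⌉₊ : ℝ) * n * (k + 1) ≤ δ / 3 * (n : ℝ) ^ 2 := by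
    have h1 := mul_le_mul_of_nonneg_right hmle (by positivity : 0 ≤ 2 * n * ((k : ℝ) + 1))
    push_cast at hgℓ
    have h2 : 2 * g * n * (2 * n * ((k : ℝ) + 1)) = 4 * (g * (k + 1)) * (n : ℝ) ^ 2 := by ring
    rw [h2, hgℓ] at h1
    linarith
  have hpos : 0 ≤ δ * (n : ℝ) ^ 2 := by positivity
  linarith
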